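/- arXiv:2011.14515 — 3 statements merged into one kernel-verified Lean document; each statement's English description precedes it below -/
import Mathlib

section
/- Let (b_n)_{n∈ℕ} be a sequence of pairwise coprime positive integers and (u_n)_{n∈ℕ} a sequence of positive integers with Σ_{n∈ℕ} b_n^{−u_n} < ∞. Let 𝔉 = {k ∈ ℤ : for every n, it is not the case that b_n^{u_n} divides k and b_n^{u_n+1} does not divide k} (i.e., for no n is the exact power of b_n dividing k equal to u_n). Then the density of 𝔉 with respect to the Følner sequence Φ_N = {−N, …, N} exists and equals ∏_{n∈ℕ} (1 − (b_n − 1)/b_n^{u_n+1}). -/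
open Filter Topology

/-- For `n : ℕ`, the exact power of `b n` dividing `k` equals `u n`. -/
def ExactPowDvd (b u : ℕ → ℕ) (n : ℕ) (k : ℤ) : Prop :=
  (b n : ℤ) ^ u n ∣ k ∧ ¬ (b n : ℤ) ^ (u n + 1) ∣ k

theorem Int.card_Icc_filter_dvd {q : ℕ} (hq : 0 < q) (N : ℕ) :
    ((Finset.Icc (-(N : ℤ)) N).filter (fun k => (q : ℤ) ∣ k)).card = 2 * (N / q) + 1 := by
  have hq' : (0 : ℤ) < q := by exact_mod_cast hq
  have h : (Finset.Icc (-(N : ℤ)) N).filter (fun k => (q : ℤ) ∣ k) =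
      (Finset.Icc (-((N / q : ℕ) : ℤ)) (N / q : ℕ)).image (fun j => (q : ℤ) * j) := by
    ext k
    simp only [Finset.mem_filter, Finset.mem_Icc, Finset.mem_image, Int.natCast_ediv]
    constructor
    · rintro ⟨⟨h1, h2⟩, j, rfl⟩
      refine ⟨j, ⟨?_, ?_⟩, rfl⟩
      · rw [neg_le, Int.le_ediv_iff_mul_le hq']
        linarith
      · rw [Int.le_ediv_iff_mul_le hq']
        linarith
    · rintro ⟨j, ⟨h1, h2⟩, rfl⟩
      rw [neg_le, Int.le_ediv_iff_mul_le hq'] at h1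
      rw [Int.le_ediv_iff_mul_le hq'] at h2
      exact ⟨⟨by linarith, by linarith⟩, dvd_mul_right _ _⟩
  rw [h, Finset.card_image_of_injective _ (mul_right_injective₀ hq'.ne')]
  simp only [Int.card_Icc]
  omega

theorem Int.card_Icc_filter_dvd_ne_zero_le {q : ℕ} (hq : 0 < q) (N : ℕ) :
    (((Finset.Icc (-(N : ℤ)) N).filter (fun k => (q : ℤ) ∣ k ∧ k ≠ 0)).card : ℝ) ≤
      1 / q * (2 * N + 1) := by
  have h : (Finset.Icc (-(N : ℤ)) N).filter (fun k => (q : ℤ) ∣ k ∧ k ≠ 0) =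
      ((Finset.Icc (-(N : ℤ)) N).filter (fun k => (q : ℤ) ∣ k)).erase 0 := by
    ext k
    simp only [Finset.mem_filter, Finset.mem_erase]
    tauto
  have hd : ((N / q : ℕ) : ℝ) ≤ N / q := Nat.cast_div_le
  have h1 : (0 : ℝ) ≤ 1 / q := by positivity
  rw [h, Finset.card_erase_of_mem (by simp), Int.card_Icc_filter_dvd hq, Nat.add_sub_cancel]
  push_cast
  calc (2 : ℝ) * (N / q : ℕ) ≤ 2 * (N / q) := by gcongr
    _ ≤ 1 / q * (2 * N + 1) := by ring_nf at h1 ⊢; linarith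

/-- The proportion of the integers in `{-N, …, N}` that satisfy `p`. -/
noncomputable def symmetricProportion (p : ℤ → Prop) (N : ℕ) : ℝ :=
  open Classical in (((Finset.Icc (-(N : ℤ)) N).filter p).card : ℝ) / (2 * N + 1)

theorem symmetricProportion_inter_add_diff (p r : ℤ → Prop) (N : ℕ) :
    symmetricProportion (fun k => p k ∧ r k) N + symmetricProportion (fun k => p k ∧ ¬ r k) N =
      symmetricProportion p N := by
  classical
  unfold symmetricProportion
  rw [← add_div, ← Nat.cast_add]
  congr 2
  convert Finset.card_filter_add_card_filter_not (s := (Finset.Icc (-(N : ℤ)) N).filter p) r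
    using 2 <;> · rw [Finset.filter_filter]; congr!

theorem tendsto_symmetricProportion_dvd {q : ℕ} (hq : 0 < q) :
    Tendsto (symmetricProportion (fun k => (q : ℤ) ∣ k)) atTop (𝓝 (1 / q)) := by
  have hq' : (0 : ℝ) < q := by exact_mod_cast hq
  have hinv : Tendsto (fun N : ℕ => 2 * ((1 : ℝ) / (N + 1))) atTop (𝓝 0) := by
    simpa using (tendsto_one_div_add_atTop_nhds_zero_nat (𝕜 := ℝ)).const_mul 2
  rw [tendsto_iff_dist_tendsto_zero]
  refine squeeze_zero (fun _ => dist_nonneg) (fun N => ?_) hinv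
  have hd : ((N / q : ℕ) : ℝ) ≤ N / q := Nat.cast_div_le
  have hd' : (N : ℝ) / q < (N / q : ℕ) + 1 := by
    rw [div_lt_iff₀ hq', mul_comm]
    exact_mod_cast Nat.lt_mul_div_succ N hq
  have hq1 : (1 : ℝ) / q ≤ 1 := div_le_one_of_le₀ (by exact_mod_cast hq) hq'.le
  have hq0 : (0 : ℝ) < 1 / q := by positivity
  have hN : (0 : ℝ) < 2 * N + 1 := by positivity
  have hcard : symmetricProportion (fun k => (q : ℤ) ∣ k) N =
      (2 * (N / q : ℕ) + 1) / (2 * N + 1) := by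
    have h := Int.card_Icc_filter_dvd hq N
    unfold symmetricProportion
    congr 1
    norm_cast
    convert h
  have hbound : |(2 * ((N / q : ℕ) : ℝ) + 1) - 1 / q * (2 * N + 1)| ≤ 2 := by
    have h : 1 / (q : ℝ) * (2 * N + 1) = 2 * (N / q) + 1 / q := by ring
    rw [h, abs_le]
    constructor <;> linarith
  rw [hcard, Real.dist_eq, div_sub' hN.ne', mul_comm (2 * (N : ℝ) + 1), abs_div, abs_of_pos hN]
  calc _ ≤ 2 / (2 * (N : ℝ) + 1) := by gcongr
    _ ≤ 2 / ((N : ℝ) + 1) := by gcongr; linarith [(Nat.cast_nonneg N : (0 : ℝ) ≤ N)]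
    _ = 2 * (1 / ((N : ℝ) + 1)) := by ring

theorem tendsto_symmetricProportion_finset (b u : ℕ → ℕ) (hbpos : ∀ n, 0 < b n)
    (hcop : ∀ m n, m ≠ n → Nat.Coprime (b m) (b n)) (s : Finset ℕ) (q : ℕ) (hq : 0 < q)
    (hqs : ∀ n ∈ s, Nat.Coprime q (b n)) :
    Tendsto (symmetricProportion (fun k => (q : ℤ) ∣ k ∧ ∀ n ∈ s, ¬ ExactPowDvd b u n k)) atTop
      (𝓝 (1 / q * ∏ n ∈ s, (1 - ((b n : ℝ) - 1) / (b n : ℝ) ^ (u n + 1)))) := by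
  induction s using Finset.induction_on generalizing q with
  | empty => simpa using tendsto_symmetricProportion_dvd hq
  | insert m s hm ih =>
    have hb : (b m : ℝ) ≠ 0 := by exact_mod_cast (hbpos m).ne'
    have hq0 : (q : ℝ) ≠ 0 := by exact_mod_cast hq.ne'
    have hqm : Nat.Coprime q (b m) := hqs m (Finset.mem_insert_self _ _)
    have hqs' : ∀ n ∈ s, Nat.Coprime q (b n) := fun n hn => hqs n (Finset.mem_insert_of_mem hn)
    have hmul (e : ℕ) : Tendsto (symmetricProportion
        (fun k => ((q * b m ^ e : ℕ) : ℤ) ∣ k ∧ ∀ n ∈ s, ¬ ExactPowDvd b u n k)) atTop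
        (𝓝 (1 / (q * b m ^ e : ℕ) *
          ∏ n ∈ s, (1 - ((b n : ℝ) - 1) / (b n : ℝ) ^ (u n + 1)))) := by
      refine ih _ (Nat.mul_pos hq (pow_pos (hbpos m) e)) fun n hn => ?_
      exact (hqs' n hn).mul_left ((hcop m n (by rintro rfl; exact hm hn)).pow_left e)
    have hdvd (e : ℕ) (k : ℤ) :
        ((q * b m ^ e : ℕ) : ℤ) ∣ k ↔ (q : ℤ) ∣ k ∧ (b m : ℤ) ^ e ∣ k := by
      have hc : IsCoprime (q : ℤ) ((b m : ℤ) ^ e) :=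
        (Nat.isCoprime_iff_coprime.mpr hqm).pow_right
      push_cast
      exact ⟨fun h => ⟨dvd_of_mul_right_dvd h, dvd_of_mul_left_dvd h⟩,
        fun h => hc.mul_dvd h.1 h.2⟩
    convert ((ih q hq hqs').sub (hmul (u m))).add (hmul (u m + 1)) using 1
    · funext N
      have h1 := symmetricProportion_inter_add_diff
        (fun k => (q : ℤ) ∣ k ∧ ∀ n ∈ s, ¬ ExactPowDvd b u n k) (ExactPowDvd b u m) N
      have h2 := symmetricProportion_inter_add_diff
        (fun k => ((q * b m ^ u m : ℕ) : ℤ) ∣ k ∧ ∀ n ∈ s, ¬ ExactPowDvd b u n k)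
        (fun k => (b m : ℤ) ^ (u m + 1) ∣ k) N
      have e1 : (fun k : ℤ => (((q * b m ^ u m : ℕ) : ℤ) ∣ k ∧ ∀ n ∈ s, ¬ ExactPowDvd b u n k) ∧
          (b m : ℤ) ^ (u m + 1) ∣ k) =
          fun k => ((q * b m ^ (u m + 1) : ℕ) : ℤ) ∣ k ∧ ∀ n ∈ s, ¬ ExactPowDvd b u n k := by
        funext k
        have : (b m : ℤ) ^ (u m + 1) ∣ k → (b m : ℤ) ^ u m ∣ k :=
          fun h => (pow_dvd_pow _ (Nat.le_succ _)).trans h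
        simp only [hdvd, eq_iff_iff]
        tauto
      have e2 : (fun k : ℤ => (((q * b m ^ u m : ℕ) : ℤ) ∣ k ∧ ∀ n ∈ s, ¬ ExactPowDvd b u n k) ∧
          ¬ (b m : ℤ) ^ (u m + 1) ∣ k) =
          fun k => ((q : ℤ) ∣ k ∧ ∀ n ∈ s, ¬ ExactPowDvd b u n k) ∧ ExactPowDvd b u m k := by
        funext k
        have : ExactPowDvd b u m k ↔ (b m : ℤ) ^ u m ∣ k ∧ ¬ (b m : ℤ) ^ (u m + 1) ∣ k := Iff.rfl
        simp only [hdvd, eq_iff_iff]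
        tauto
      have e3 : (fun k : ℤ => (q : ℤ) ∣ k ∧ ∀ n ∈ insert m s, ¬ ExactPowDvd b u n k) =
          fun k => ((q : ℤ) ∣ k ∧ ∀ n ∈ s, ¬ ExactPowDvd b u n k) ∧ ¬ ExactPowDvd b u m k := by
        funext k
        simp only [Finset.forall_mem_insert, eq_iff_iff]
        tauto
      rw [e1, e2] at h2
      rw [e3]
      linarith
    · rw [Finset.prod_insert hm]
      congr 1
      push_cast
      field_simp
      ring

theorem symmetricProportion_finset_sub_le (b u : ℕ → ℕ) (hbpos : ∀ n, 0 < b n)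
    (s : Finset ℕ) {ε : ℝ}
    (hs : ∀ t : Finset ℕ, Disjoint t s → ∑ n ∈ t, (1 : ℝ) / (b n : ℝ) ^ u n ≤ ε) (N : ℕ) :
    |symmetricProportion (fun k => ∀ n, ¬ ExactPowDvd b u n k) N -
      symmetricProportion (fun k => ∀ n ∈ s, ¬ ExactPowDvd b u n k) N| ≤ ε := by
  classical
  have hsplit := symmetricProportion_inter_add_diff
    (fun k => ∀ n ∈ s, ¬ ExactPowDvd b u n k) (fun k => ∀ n, ¬ ExactPowDvd b u n k) N
  have e1 : (fun k : ℤ => (∀ n ∈ s, ¬ ExactPowDvd b u n k) ∧ ∀ n, ¬ ExactPowDvd b u n k) =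
      fun k => ∀ n, ¬ ExactPowDvd b u n k := by
    funext k
    exact propext ⟨And.right, fun h => ⟨fun n _ => h n, h⟩⟩
  rw [e1] at hsplit
  rw [← hsplit, sub_add_cancel_left, abs_neg]
  have hN : (0 : ℝ) < 2 * N + 1 := by positivity
  unfold symmetricProportion
  rw [abs_of_nonneg (by positivity), div_le_iff₀ hN]
  set S := (Finset.Icc (-(N : ℤ)) N).filter
    (fun k => (∀ n ∈ s, ¬ ExactPowDvd b u n k) ∧ ¬ ∀ n, ¬ ExactPowDvd b u n k) with hS
  have hex : ∀ k ∈ S, ∃ n, n ∉ s ∧ ExactPowDvd b u n k := by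
    intro k hk
    obtain ⟨-, h1, h2⟩ := Finset.mem_filter.mp hk
    push Not at h2
    obtain ⟨n, hn⟩ := h2
    exact ⟨n, fun hns => h1 n hns hn, hn⟩
  choose! f hfs hf using hex
  have hsub : S ⊆ (S.image f).biUnion fun n =>
      (Finset.Icc (-(N : ℤ)) N).filter (fun k => ((b n ^ u n : ℕ) : ℤ) ∣ k ∧ k ≠ 0) := by
    intro k hk
    refine Finset.mem_biUnion.mpr ⟨f k, Finset.mem_image_of_mem f hk, Finset.mem_filter.mpr
      ⟨(Finset.mem_filter.mp hk).1, by exact_mod_cast (hf k hk).1, ?_⟩⟩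
    rintro rfl
    exact (hf 0 hk).2 (dvd_zero _)
  have hdisj : Disjoint (S.image f) s := by
    rw [Finset.disjoint_left]
    intro n hn
    obtain ⟨k, hk, rfl⟩ := Finset.mem_image.mp hn
    exact hfs k hk
  calc _ = (S.card : ℝ) := by rw [hS]; congr!
    _ ≤ ∑ n ∈ S.image f, (((Finset.Icc (-(N : ℤ)) N).filter
        (fun k => ((b n ^ u n : ℕ) : ℤ) ∣ k ∧ k ≠ 0)).card : ℝ) := by
        exact_mod_cast (Finset.card_le_card hsub).trans Finset.card_biUnion_le
    _ ≤ ∑ n ∈ S.image f, (1 : ℝ) / (b n : ℝ) ^ u n * (2 * N + 1) := by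
        refine Finset.sum_le_sum fun n _ => ?_
        exact_mod_cast Int.card_Icc_filter_dvd_ne_zero_le (pow_pos (hbpos n) (u n)) N
    _ ≤ ε * (2 * N + 1) := by
        rw [← Finset.sum_mul]
        exact mul_le_mul_of_nonneg_right (hs _ hdisj) hN.le

theorem multipliable_one_sub_exactPowDvd (b u : ℕ → ℕ) (hbpos : ∀ n, 0 < b n)
    (hsum : Summable (fun n => (1 : ℝ) / (b n : ℝ) ^ (u n))) :
    Multipliable (fun n => 1 - ((b n : ℝ) - 1) / (b n : ℝ) ^ (u n + 1)) := by
  simp only [sub_eq_add_neg (1 : ℝ)]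
  refine multipliable_one_add_of_summable (hsum.of_nonneg_of_le (fun _ => norm_nonneg _) fun n => ?_)
  have hb : (1 : ℝ) ≤ b n := by exact_mod_cast hbpos n
  have hb0 : (0 : ℝ) < b n := by linarith
  rw [norm_neg, Real.norm_of_nonneg (div_nonneg (by linarith) (by positivity)),
    div_le_div_iff₀ (by positivity) (by positivity), pow_succ]
  nlinarith [pow_pos hb0 (u n)]

open Classical in
/-- Let `(b n)` be pairwise coprime positive integers and `(u n)` positive
integers with `Σ bₙ^{−uₙ} < ∞`.  The set `𝔉` of integers `k` such that for no
`n` the exact power of `bₙ` dividing `k` equals `uₙ` has density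
`∏ₙ (1 − (bₙ − 1)/bₙ^{uₙ+1})` along the intervals `{−N, …, N}`. -/
theorem byfree_density (b : ℕ → ℕ) (u : ℕ → ℕ)
    (hbpos : ∀ n, 0 < b n) (hupos : ∀ n, 0 < u n)
    (hcop : ∀ m n, m ≠ n → Nat.Coprime (b m) (b n))
    (hsum : Summable (fun n => (1 : ℝ) / (b n : ℝ) ^ (u n))) :
    Tendsto
      (fun N : ℕ =>
        (((Finset.Icc (-(N : ℤ)) (N : ℤ)).filter
          (fun k : ℤ => ∀ n : ℕ,
            ¬ ((b n : ℤ) ^ (u n) ∣ k ∧ ¬ (b n : ℤ) ^ (u n + 1) ∣ k))).card : ℝ)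
          / (2 * N + 1))
      atTop
      (nhds (∏' n : ℕ, (1 - ((b n : ℝ) - 1) / (b n : ℝ) ^ (u n + 1)))) := by
  have hP := (multipliable_one_sub_exactPowDvd b u hbpos hsum).hasProd
  suffices h : Tendsto (symmetricProportion (fun k => ∀ n, ¬ ExactPowDvd b u n k)) atTop
      (𝓝 (∏' n : ℕ, (1 - ((b n : ℝ) - 1) / (b n : ℝ) ^ (u n + 1)))) from h
  have hunif : TendstoUniformly
      (fun s : Finset ℕ => symmetricProportion (fun k => ∀ n ∈ s, ¬ ExactPowDvd b u n k))
      (symmetricProportion (fun k => ∀ n, ¬ ExactPowDvd b u n k)) atTop := by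
    rw [Metric.tendstoUniformly_iff]
    intro ε hε
    obtain ⟨s₀, hs₀⟩ := summable_iff_vanishing_norm.mp hsum (ε / 2) (half_pos hε)
    filter_upwards [eventually_ge_atTop s₀] with s hs N
    refine (symmetricProportion_finset_sub_le b u hbpos s (fun t ht => ?_) N).trans_lt
      (half_lt_self hε)
    exact (le_abs_self _).trans (hs₀ t (ht.mono_right hs)).le
  refine hunif.tendsto_of_eventually_tendsto (.of_forall fun s => ?_) hP
  simpa using tendsto_symmetricProportion_finset b u hbpos hcop s 1 one_pos
    fun n _ => Nat.coprime_one_left _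
end

section
/- For n ∈ ℕ let F_n = {M ∈ SL₂(ℤ) : every entry of M has absolute value at most n}, and for A ⊆ SL₂(ℤ) define the lower density d̲(A) = liminf_{n→∞} |A ∩ F_n|/|F_n|. Let (b_n)_{n∈ℕ} be a sequence of pairwise coprime positive integers with Σ_{n∈ℕ} 8π²/b_n² < 1, and let A = SL₂(ℤ) \ ⋃_{n∈ℕ} Γ(b_n). Then d̲(A) ≥ 1 − Σ_{n∈ℕ} 8π²/b_n² > 0. -/
open Filter

/-- `SL₂(ℤ)`. -/
abbrev SL2Z := Matrix.SpecialLinearGroup (Fin 2) ℤ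

/-- The principal congruence subgroup `Γ(n)`: the kernel of entrywise
reduction `SL₂(ℤ) → SL₂(ℤ/nℤ)`. -/
def GammaSL (n : ℕ) : Subgroup SL2Z :=
  (Matrix.SpecialLinearGroup.map (n := Fin 2) (Int.castRingHom (ZMod n))).ker

/-- The finite box `F_n` of matrices in `SL₂(ℤ)` all of whose entries have
absolute value at most `n`. -/
def SLbox (n : ℕ) : Set SL2Z :=
  {M : SL2Z | ∀ i j : Fin 2, |(M : Matrix (Fin 2) (Fin 2) ℤ) i j| ≤ (n : ℤ)}

/-- The lower density of `A ⊆ SL₂(ℤ)` along the boxes `F_n`. -/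
noncomputable def lowerDensitySL (A : Set SL2Z) : ℝ :=
  liminf (fun n : ℕ => (Nat.card ↥(A ∩ SLbox n) : ℝ) / (Nat.card ↥(SLbox n) : ℝ)) atTop

lemma SLbox_finite (N : ℕ) : (SLbox N).Finite := by
  have h : (Set.pi Set.univ fun _ : Fin 2 => Set.pi Set.univ fun _ : Fin 2 =>
      Set.Icc (-(N : ℤ)) N).Finite :=
    Set.Finite.pi fun _ => Set.Finite.pi fun _ => Set.finite_Icc _ _
  refine (h.preimage (f := fun M : SL2Z => (M : Matrix (Fin 2) (Fin 2) ℤ))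
    Subtype.val_injective.injOn).subset ?_
  intro M hM i _ j _
  exact abs_le.mp (hM i j)

lemma SL2Z_det (M : SL2Z) : M 0 0 * M 1 1 - M 0 1 * M 1 0 = 1 := by
  rw [← Matrix.det_fin_two, M.det_coe]

lemma mem_GammaSL_iff {q : ℕ} {M : SL2Z} : M ∈ GammaSL q ↔
    (q : ℤ) ∣ M 0 0 - 1 ∧ (q : ℤ) ∣ M 0 1 ∧ (q : ℤ) ∣ M 1 0 ∧ (q : ℤ) ∣ M 1 1 - 1 := by
  have h : M ∈ GammaSL q ↔ ((M 0 0 : ℤ) : ZMod q) = 1 ∧ ((M 0 1 : ℤ) : ZMod q) = 0 ∧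
      ((M 1 0 : ℤ) : ZMod q) = 0 ∧ ((M 1 1 : ℤ) : ZMod q) = 1 := by
    rw [GammaSL, MonoidHom.mem_ker]
    constructor
    · intro h
      have h' : ∀ i j, ((M i j : ℤ) : ZMod q) = (1 : Matrix (Fin 2) (Fin 2) (ZMod q)) i j := by
        intro i j
        have := congrArg (fun A : Matrix.SpecialLinearGroup (Fin 2) (ZMod q) => A i j) h
        simpa using this
      exact ⟨by simpa using h' 0 0, by simpa using h' 0 1, by simpa using h' 1 0,
        by simpa using h' 1 1⟩
    · rintro ⟨h1, h2, h3, h4⟩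
      ext i j
      fin_cases i <;> fin_cases j <;> simp [h1, h2, h3, h4]
  rw [h]
  simp only [← ZMod.intCast_zmod_eq_zero_iff_dvd]
  simp [sub_eq_zero]

/-- A unimodular matrix is determined by its congruence class modulo `q ≥ 3` and its bottom row
if no entry of the top row exceeds the largest entry of the bottom row. -/
lemma top_row_unique {q : ℕ} (hq : 3 ≤ q) {a b a' b' c d : ℤ}
    (h : a * d - b * c = 1) (h' : a' * d - b' * c = 1)
    (haa : (q : ℤ) ∣ a - a') (hbb : (q : ℤ) ∣ b - b')
    (ha : |a| ≤ max |c| |d|) (hb : |b| ≤ max |c| |d|)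
    (ha' : |a'| ≤ max |c| |d|) (hb' : |b'| ≤ max |c| |d|) : a = a' ∧ b = b' := by
  set k := a * b' - b * a' with hk
  have hka : a' - a = k * c := by rw [hk]; linear_combination a * h' - a' * h
  have hkb : b' - b = k * d := by rw [hk]; linear_combination b * h' - b' * h
  have hqk : (q : ℤ) ∣ k := by
    have : k = a * (b' - b) - b * (a' - a) := by rw [hk]; ring
    rw [this]
    exact dvd_sub ((dvd_sub_comm.mp hbb).mul_left _) ((dvd_sub_comm.mp haa).mul_left _)
  have hk0 : k = 0 := by
    by_contra hne
    have hle : (q : ℤ) ≤ |k| := Int.le_of_dvd (abs_pos.mpr hne) ((dvd_abs _ _).mpr hqk)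
    have hk3 : 3 ≤ |k| := le_trans (by exact_mod_cast hq) hle
    have e1 : |k| * |c| ≤ 2 * max |c| |d| := by
      rw [← abs_mul, ← hka]; have := abs_sub a' a; linarith
    have e2 : |k| * |d| ≤ 2 * max |c| |d| := by
      rw [← abs_mul, ← hkb]; have := abs_sub b' b; linarith
    have e3 : |k| * max |c| |d| ≤ 2 * max |c| |d| := by
      rw [mul_max_of_nonneg _ _ (abs_nonneg k)]
      exact max_le e1 e2
    have hm : 0 < max |c| |d| := by
      rcases eq_or_ne c 0 with rfl | hc
      · exact lt_max_of_lt_right (abs_pos.mpr (by rintro rfl; simp at h))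
      · exact lt_max_of_lt_left (abs_pos.mpr hc)
    nlinarith
  rw [hk0] at hka hkb
  constructor <;> linarith

lemma card_Icc_modEq_le {N q : ℕ} (hq : 9 ≤ q) (hqN : q ≤ N) (v : ℤ) :
    (((Finset.Ioc (-(N : ℤ) - 1) N).filter (· ≡ v [ZMOD q])).card : ℝ) ≤ 28 / 9 * N / q := by
  have hq0 : (0 : ℤ) < q := by omega
  have hcard := Int.Ioc_filter_modEq_card (-(N : ℤ) - 1) N hq0 v
  have hqR : (9 : ℝ) ≤ q := by exact_mod_cast hq
  have hNR : (q : ℝ) ≤ N := by exact_mod_cast hqN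
  have h1 := Int.floor_le (((N : ℤ) - v : ℤ) / (q : ℤ) : ℚ)
  have h2 := Int.lt_floor_add_one (((-(N : ℤ) - 1) - v : ℤ) / (q : ℤ) : ℚ)
  have hcR : (((Finset.Ioc (-(N : ℤ) - 1) N).filter (· ≡ v [ZMOD q])).card : ℚ) ≤
      (2 * N + 1) / q + 1 := by
    have := congrArg (Int.cast : ℤ → ℚ) hcard
    push_cast at this h1 h2
    rw [this]
    apply max_le
    · have : ((2 * N + 1) / q : ℚ) = (N - v) / q - (-N - 1 - v) / q := by ring
      linarith
    · positivity
  have hcR' : (((Finset.Ioc (-(N : ℤ) - 1) N).filter (· ≡ v [ZMOD q])).card : ℝ) ≤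
      (2 * N + 1) / q + 1 := by
    have := (Rat.cast_le (K := ℝ)).mpr hcR
    push_cast at this
    exact this
  refine hcR'.trans ?_
  rw [div_add_one (by positivity), div_le_div_iff_of_pos_right (by positivity)]
  linarith

lemma ncard_row_le {N q : ℕ} (hq : 9 ≤ q) (hqN : q ≤ N) (S : Set SL2Z) (f : SL2Z → ℤ × ℤ)
    (hf : Set.InjOn f S) (hb : ∀ M ∈ S, |(f M).1| ≤ N ∧ |(f M).2| ≤ N ∧
      (q : ℤ) ∣ (f M).1 ∧ (q : ℤ) ∣ (f M).2 - 1) :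
    (S.ncard : ℝ) ≤ (28 / 9 * N / q) ^ 2 := by
  set I := fun v : ℤ => (Finset.Ioc (-(N : ℤ) - 1) N).filter (· ≡ v [ZMOD q])
  have h : S.ncard ≤ (I 0 ×ˢ I 1).card := by
    rw [← Set.ncard_coe_finset]
    refine Set.ncard_le_ncard_of_injOn f ?_ hf (Finset.finite_toSet _)
    intro M hM
    obtain ⟨h1, h2, h3, h4⟩ := hb M hM
    rw [abs_le] at h1 h2
    simp only [I, Finset.coe_product, Finset.coe_filter, Set.mem_prod, Set.mem_ofPred_eq,
      Finset.mem_Ioc]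
    exact ⟨⟨⟨by omega, h1.2⟩, (Int.modEq_zero_iff_dvd).mpr h3⟩, ⟨by omega, h2.2⟩,
      (Int.modEq_iff_dvd.mpr h4).symm⟩
  rw [Finset.card_product] at h
  calc (S.ncard : ℝ) ≤ (I 0).card * (I 1).card := by exact_mod_cast h
    _ ≤ (28 / 9 * N / q) * (28 / 9 * N / q) := by
      gcongr
      · exact card_Icc_modEq_le hq hqN 0
      · exact card_Icc_modEq_le hq hqN 1
    _ = _ := by ring

lemma ncard_GammaSL_inter_SLbox_le {N q : ℕ} (hq : 9 ≤ q) (hqN : q ≤ N) :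
    (((GammaSL q : Set SL2Z) ∩ SLbox N).ncard : ℝ) ≤ 2 * (28 / 9 * N / q) ^ 2 := by
  set G := (GammaSL q : Set SL2Z) ∩ SLbox N
  set P : Set SL2Z := {M | max |M 0 0| |M 0 1| ≤ max |M 1 0| |M 1 1|}
  have hsub : G ⊆ (G ∩ P) ∪ (G \ P) := (Set.inter_union_sdiff G P).ge
  have hfin : G.Finite := (SLbox_finite N).subset Set.inter_subset_right
  have hle : G.ncard ≤ (G ∩ P).ncard + (G \ P).ncard :=
    (Set.ncard_le_ncard hsub (by rwa [Set.inter_union_sdiff])).trans (Set.ncard_union_le _ _)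
  have h1 : ((G ∩ P).ncard : ℝ) ≤ (28 / 9 * N / q) ^ 2 := by
    refine ncard_row_le hq hqN _ (fun M => (M 1 0, M 1 1)) ?_ ?_
    · rintro M ⟨⟨hM, -⟩, hMP⟩ M' ⟨⟨hM', -⟩, hMP'⟩ h
      obtain ⟨hc, hd⟩ := Prod.ext_iff.mp h
      simp only at hc hd
      simp only [P, Set.mem_ofPred_eq, max_le_iff, ← hc, ← hd] at hMP hMP'
      obtain ⟨e1, e2, -, -⟩ := mem_GammaSL_iff.mp hM
      obtain ⟨e1', e2', -, -⟩ := mem_GammaSL_iff.mp hM'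
      have hdet' := SL2Z_det M'
      rw [← hc, ← hd] at hdet'
      obtain ⟨ha, hb⟩ := top_row_unique (by omega : 3 ≤ q) (SL2Z_det M) hdet'
        (by simpa using dvd_sub e1 e1') (dvd_sub e2 e2') hMP.1 hMP.2 hMP'.1 hMP'.2
      ext i j
      fin_cases i <;> fin_cases j <;> assumption
    · rintro M ⟨⟨hM, hMN⟩, -⟩
      obtain ⟨-, -, e3, e4⟩ := mem_GammaSL_iff.mp hM
      exact ⟨hMN 1 0, hMN 1 1, e3, e4⟩
  have h2 : ((G \ P).ncard : ℝ) ≤ (28 / 9 * N / q) ^ 2 := by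
    refine ncard_row_le hq hqN _ (fun M => (M 0 1, M 0 0)) ?_ ?_
    · rintro M ⟨⟨hM, -⟩, hMP⟩ M' ⟨⟨hM', -⟩, hMP'⟩ h
      obtain ⟨hc, hd⟩ := Prod.ext_iff.mp h
      simp only at hc hd
      simp only [P, Set.mem_ofPred_eq, not_le, ← hc, ← hd] at hMP hMP'
      replace hMP := max_le_iff.mp hMP.le
      replace hMP' := max_le_iff.mp hMP'.le
      rw [max_comm] at hMP hMP'
      obtain ⟨-, -, e1, e2⟩ := mem_GammaSL_iff.mp hM
      obtain ⟨-, -, e1', e2'⟩ := mem_GammaSL_iff.mp hM'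
      have hdet := SL2Z_det M
      have hdet' := SL2Z_det M'
      rw [← hc, ← hd] at hdet'
      obtain ⟨ha, hb⟩ := top_row_unique (by omega : 3 ≤ q)
        (by linarith : M 1 1 * M 0 0 - M 1 0 * M 0 1 = 1)
        (by linarith : M' 1 1 * M 0 0 - M' 1 0 * M 0 1 = 1)
        (by simpa using dvd_sub e2 e2') (dvd_sub e1 e1') hMP.2 hMP.1 hMP'.2 hMP'.1
      ext i j
      fin_cases i <;> fin_cases j <;> assumption
    · rintro M ⟨⟨hM, hMN⟩, -⟩
      obtain ⟨e1, e2, -, -⟩ := mem_GammaSL_iff.mp hM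
      exact ⟨hMN 0 1, hMN 0 0, e2, e1⟩
  have : (G.ncard : ℝ) ≤ (G ∩ P).ncard + (G \ P).ncard := by exact_mod_cast hle
  linarith

lemma GammaSL_inter_SLbox_of_lt {N q : ℕ} (hq : 9 ≤ q) (hNq : N < q) :
    (GammaSL q : Set SL2Z) ∩ SLbox N ⊆ {1} := by
  rintro M ⟨hM, hMN⟩
  obtain ⟨e1, e2, e3, e4⟩ := mem_GammaSL_iff.mp hM
  have hlt : ∀ i j, |M i j| < (q : ℤ) := fun i j =>
    (hMN i j).trans_lt (by exact_mod_cast hNq)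
  have hb := Int.eq_zero_of_abs_lt_dvd e2 (hlt 0 1)
  have hc := Int.eq_zero_of_abs_lt_dvd e3 (hlt 1 0)
  have hdet := SL2Z_det M
  rw [hb, hc, mul_zero, sub_zero] at hdet
  have had : M 0 0 = 1 ∧ M 1 1 = 1 := by
    rcases Int.mul_eq_one_iff_eq_one_or_neg_one.mp hdet with h | h
    · exact h
    · rw [h.1] at e1
      have := Int.le_of_dvd (by norm_num) (dvd_neg.mpr e1)
      omega
  rw [Set.mem_singleton_iff]
  ext i j
  fin_cases i <;> fin_cases j <;> simp [had.1, had.2, hb, hc]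

lemma exists_mem_SLbox_of_coprime {N c d : ℕ} (hc : 0 < c) (hcN : c ≤ N) (hd : 0 < d)
    (hdN : d ≤ N) (h : Nat.Coprime c d) : ∃ M ∈ SLbox N, M 1 0 = c ∧ M 1 1 = d := by
  obtain ⟨v, u, huv⟩ := Nat.isCoprime_iff_coprime.mpr h
  set a := u % (c : ℤ) with ha
  set b := -(v + d * (u / c)) with hb
  have hdet : a * d - b * c = 1 := by
    have := Int.emod_add_mul_ediv u c
    rw [hb]
    linear_combination huv + d * this
  have hc' : (0 : ℤ) < c := by exact_mod_cast hc
  have hd' : (0 : ℤ) < d := by exact_mod_cast hd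
  have ha0 : 0 ≤ a := Int.emod_nonneg _ hc'.ne'
  have hac : a < c := Int.emod_lt_of_pos _ hc'
  have hbd : b < d := by
    by_contra! hcon
    nlinarith
  have hb1 : -1 ≤ b := by
    by_contra! hcon
    nlinarith
  refine ⟨⟨!![a, b; c, d], by rw [Matrix.det_fin_two_of]; exact hdet⟩, ?_, by simp, by simp⟩
  intro i j
  fin_cases i <;> fin_cases j <;> simp [abs_le] <;> omega

lemma sum_Icc_two_inv_sq_le (N : ℕ) :
    ∑ k ∈ Finset.Icc 2 N, 1 / (k : ℝ) ^ 2 ≤ Real.pi ^ 2 / 6 - 1 := by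
  have h := sum_le_hasSum (insert 1 (Finset.Icc 2 N)) (fun _ _ => by positivity) hasSum_zeta_two
  rw [Finset.sum_insert (by simp)] at h
  simp only [Nat.cast_one, one_pow, div_one] at h
  linarith

lemma ncard_SLbox_ge (N : ℕ) : (2 - Real.pi ^ 2 / 6) * (N : ℝ) ^ 2 ≤ (SLbox N).ncard := by
  set Q := Finset.Ioc 0 N ×ˢ Finset.Ioc 0 N with hQ
  set C := Q.filter fun p => Nat.Coprime p.1 p.2
  have hC : C.card ≤ (SLbox N).ncard := by
    rw [← Set.ncard_coe_finset]
    refine (Set.ncard_le_ncard (t := (fun M : SL2Z => ((M 1 0).natAbs, (M 1 1).natAbs)) '' SLbox N)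
      ?_ ((SLbox_finite N).image _)).trans (Set.ncard_image_le (SLbox_finite N))
    rintro ⟨c, d⟩ h
    simp only [C, Q, Finset.coe_filter, Set.mem_ofPred_eq, Finset.mem_product,
      Finset.mem_Ioc] at h
    obtain ⟨M, hM, h1, h2⟩ :=
      exists_mem_SLbox_of_coprime h.1.1.1 h.1.1.2 h.1.2.1 h.1.2.2 h.2
    exact ⟨M, hM, by simp [h1, h2]⟩
  have hD : ((Q.filter fun p => ¬ Nat.Coprime p.1 p.2).card : ℝ) ≤
      (Real.pi ^ 2 / 6 - 1) * (N : ℝ) ^ 2 := by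
    have hsub : (Q.filter fun p => ¬ Nat.Coprime p.1 p.2) ⊆ (Finset.Icc 2 N).biUnion fun k =>
        (Finset.Ioc 0 N).filter (k ∣ ·) ×ˢ (Finset.Ioc 0 N).filter (k ∣ ·) := by
      rintro ⟨c, d⟩ h
      simp only [Q, Finset.mem_filter, Finset.mem_product, Finset.mem_Ioc] at h
      simp only [Finset.mem_biUnion, Finset.mem_filter, Finset.mem_product, Finset.mem_Ioc,
        Finset.mem_Icc]
      have hg : Nat.gcd c d ≠ 1 := h.2
      have hg0 := Nat.gcd_pos_of_pos_left d h.1.1.1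
      have hgc := Nat.gcd_le_left d h.1.1.1
      exact ⟨Nat.gcd c d, ⟨by omega, by omega⟩, ⟨h.1.1, Nat.gcd_dvd_left c d⟩,
        h.1.2, Nat.gcd_dvd_right c d⟩
    have hcard := (Finset.card_le_card hsub).trans Finset.card_biUnion_le
    simp only [Finset.card_product, Nat.Ioc_filter_dvd_card_eq_div] at hcard
    calc ((Q.filter fun p => ¬ Nat.Coprime p.1 p.2).card : ℝ)
        ≤ ∑ k ∈ Finset.Icc 2 N, ((N / k : ℕ) : ℝ) * ((N / k : ℕ) : ℝ) := by exact_mod_cast hcard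
      _ ≤ ∑ k ∈ Finset.Icc 2 N, 1 / (k : ℝ) ^ 2 * (N : ℝ) ^ 2 := by
        refine Finset.sum_le_sum fun k _ => ?_
        calc ((N / k : ℕ) : ℝ) * ((N / k : ℕ) : ℝ) ≤ ((N : ℝ) / k) * ((N : ℝ) / k) := by
              gcongr <;> exact Nat.cast_div_le
          _ = _ := by ring
      _ ≤ _ := by
        rw [← Finset.sum_mul]
        gcongr
        exact sum_Icc_two_inv_sq_le N
  have hsplit : (C.card : ℝ) + (Q.filter fun p => ¬ Nat.Coprime p.1 p.2).card = (N : ℝ) ^ 2 := by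
    have := Finset.card_filter_add_card_filter_not (s := Q) fun p => Nat.Coprime p.1 p.2
    rw [hQ, Finset.card_product, Nat.card_Ioc, Nat.sub_zero, ← hQ, ← sq] at this
    exact_mod_cast this
  have hCR : (C.card : ℝ) ≤ (SLbox N).ncard := by exact_mod_cast hC
  linarith

lemma ncard_GammaSL_inter_SLbox_le_mul {N q : ℕ} (hq : 9 ≤ q) (hqN : q ≤ N) :
    (((GammaSL q : Set SL2Z) ∩ SLbox N).ncard : ℝ) ≤
      8 * Real.pi ^ 2 / (q : ℝ) ^ 2 * (SLbox N).ncard := by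
  refine (ncard_GammaSL_inter_SLbox_le hq hqN).trans ?_
  have hpi : 2 * (28 / 9) ^ 2 ≤ 8 * Real.pi ^ 2 * (2 - Real.pi ^ 2 / 6) := by
    have h1 := Real.pi_gt_three
    have h2 := Real.pi_lt_d2
    have h3 : Real.pi ^ 2 ≤ 10 := by nlinarith
    have h4 : 9 ≤ Real.pi ^ 2 := by nlinarith
    nlinarith
  calc 2 * (28 / 9 * (N : ℝ) / q) ^ 2 = 2 * (28 / 9) ^ 2 * ((N : ℝ) ^ 2 / (q : ℝ) ^ 2) := by ring
    _ ≤ 8 * Real.pi ^ 2 * (2 - Real.pi ^ 2 / 6) * ((N : ℝ) ^ 2 / (q : ℝ) ^ 2) := by gcongr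
    _ = 8 * Real.pi ^ 2 / (q : ℝ) ^ 2 * ((2 - Real.pi ^ 2 / 6) * (N : ℝ) ^ 2) := by ring
    _ ≤ _ := by
      gcongr
      exact ncard_SLbox_ge N

lemma ncard_iUnion_GammaSL_le {b : ℕ → ℕ} (hb : ∀ n, 9 ≤ b n)
    (hs : Summable fun n => 8 * Real.pi ^ 2 / (b n : ℝ) ^ 2) (N : ℕ) :
    (((⋃ n, (GammaSL (b n) : Set SL2Z)) ∩ SLbox N).ncard : ℝ) ≤
      1 + (∑' n, 8 * Real.pi ^ 2 / (b n : ℝ) ^ 2) * (SLbox N).ncard := by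
  have hT : {n | b n ≤ N}.Finite := by
    have h := hs.tendsto_cofinite_zero.eventually
      (gt_mem_nhds (show 0 < 8 * Real.pi ^ 2 / ((N : ℝ) + 1) ^ 2 by positivity))
    refine Set.Finite.subset (eventually_cofinite.mp h) fun n hn => ?_
    have hn' : (b n : ℝ) ≤ N := by exact_mod_cast hn
    have hb0 : (0 : ℝ) < b n := by exact_mod_cast (by have := hb n; omega : 0 < b n)
    simp only [Set.mem_ofPred_eq, not_lt]
    gcongr
    linarith
  set T := hT.toFinset
  have hsub : (⋃ n, (GammaSL (b n) : Set SL2Z)) ∩ SLbox N ⊆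
      {1} ∪ ⋃ n ∈ T, (GammaSL (b n) : Set SL2Z) ∩ SLbox N := by
    rintro M ⟨hM, hMN⟩
    obtain ⟨n, hn⟩ := Set.mem_iUnion.mp hM
    by_cases h : b n ≤ N
    · right
      simp only [Set.mem_iUnion]
      exact ⟨n, hT.mem_toFinset.mpr h, hn, hMN⟩
    · exact Or.inl (GammaSL_inter_SLbox_of_lt (hb n) (not_le.mp h) ⟨hn, hMN⟩)
  have hfin : ({1} ∪ ⋃ n ∈ T, (GammaSL (b n) : Set SL2Z) ∩ SLbox N).Finite :=
    (Set.finite_singleton _).union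
      (T.finite_toSet.biUnion fun _ _ => (SLbox_finite N).subset Set.inter_subset_right)
  have h1 : ((⋃ n, (GammaSL (b n) : Set SL2Z)) ∩ SLbox N).ncard ≤
      1 + ∑ n ∈ T, ((GammaSL (b n) : Set SL2Z) ∩ SLbox N).ncard := by
    refine (Set.ncard_le_ncard hsub hfin).trans ((Set.ncard_union_le _ _).trans ?_)
    rw [Set.ncard_singleton]
    gcongr
    exact Finset.set_ncard_biUnion_le _ _
  calc (((⋃ n, (GammaSL (b n) : Set SL2Z)) ∩ SLbox N).ncard : ℝ)
      ≤ 1 + ∑ n ∈ T, (((GammaSL (b n) : Set SL2Z) ∩ SLbox N).ncard : ℝ) := by exact_mod_cast h1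
    _ ≤ 1 + ∑ n ∈ T, 8 * Real.pi ^ 2 / (b n : ℝ) ^ 2 * (SLbox N).ncard := by
      gcongr with n hn
      exact ncard_GammaSL_inter_SLbox_le_mul (hb n) (hT.mem_toFinset.mp hn)
    _ ≤ _ := by
      rw [← Finset.sum_mul]
      gcongr
      exact hs.sum_le_tsum _ fun _ _ => by positivity

lemma tendsto_ncard_SLbox : Tendsto (fun N => ((SLbox N).ncard : ℝ)) atTop atTop := by
  have hpi : 0 < 2 - Real.pi ^ 2 / 6 := by
    nlinarith [Real.pi_lt_d2, Real.pi_gt_three]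
  refine tendsto_atTop_mono ncard_SLbox_ge (Tendsto.const_mul_atTop hpi ?_)
  exact (tendsto_pow_atTop two_ne_zero).comp tendsto_natCast_atTop_atTop

/-- If `(b n)` are pairwise coprime positive integers with
`Σ 8π²/bₙ² < 1`, then `A = SL₂(ℤ) \ ⋃ₙ Γ(bₙ)` has lower density at least
`1 − Σ 8π²/bₙ² > 0`. -/
theorem sl2z_lower_density (b : ℕ → ℕ) (hpos : ∀ n, 0 < b n)
    (hcop : ∀ m n, m ≠ n → Nat.Coprime (b m) (b n))
    (hsummable : Summable (fun n => 8 * Real.pi ^ 2 / (b n : ℝ) ^ 2))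
    (hsum : ∑' n : ℕ, 8 * Real.pi ^ 2 / (b n : ℝ) ^ 2 < 1) :
    1 - ∑' n : ℕ, 8 * Real.pi ^ 2 / (b n : ℝ) ^ 2 ≤
        lowerDensitySL (Set.univ \ ⋃ n, (GammaSL (b n) : Set SL2Z)) ∧
    0 < lowerDensitySL (Set.univ \ ⋃ n, (GammaSL (b n) : Set SL2Z)) := by
  have hb : ∀ n, 9 ≤ b n := by
    intro n
    by_contra! hlt
    have h1 := (hsummable.le_tsum n fun _ _ => by positivity).trans_lt hsum
    have h0 : (0 : ℝ) < b n := by exact_mod_cast hpos n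
    have h8 : (b n : ℝ) ≤ 8 := by exact_mod_cast (by omega : b n ≤ 8)
    rw [div_lt_one (by positivity)] at h1
    nlinarith [Real.pi_gt_three]
  set S := ∑' n : ℕ, 8 * Real.pi ^ 2 / (b n : ℝ) ^ 2
  suffices h : 1 - S ≤ lowerDensitySL (Set.univ \ ⋃ n, (GammaSL (b n) : Set SL2Z)) from
    ⟨h, by linarith⟩
  have hlim : Tendsto (fun N => 1 - S - ((SLbox N).ncard : ℝ)⁻¹) atTop (nhds (1 - S)) := by
    simpa using tendsto_ncard_SLbox.inv_tendsto_atTop.const_sub (1 - S)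
  unfold lowerDensitySL
  rw [← hlim.liminf_eq]
  simp only [Nat.card_coe_set_eq]
  refine liminf_le_liminf ?_ hlim.isBoundedUnder_ge ?_
  · filter_upwards [tendsto_ncard_SLbox.eventually_gt_atTop 0] with N hN
    rw [le_div_iff₀ hN, sub_mul, inv_mul_cancel₀ hN.ne']
    set U := ⋃ n, (GammaSL (b n) : Set SL2Z)
    have hU : ((U ∩ SLbox N).ncard : ℝ) ≤ 1 + S * (SLbox N).ncard :=
      ncard_iUnion_GammaSL_le hb hsummable N
    have hsplit := Set.ncard_inter_add_ncard_sdiff_eq_ncard (SLbox N) U (SLbox_finite N)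
    have heq : (Set.univ \ U) ∩ SLbox N = SLbox N \ U := by
      ext M; simp [and_comm]
    rw [heq]
    rw [Set.inter_comm] at hsplit
    have : ((U ∩ SLbox N).ncard : ℝ) + (SLbox N \ U).ncard = (SLbox N).ncard := by
      exact_mod_cast hsplit
    linarith
  · refine IsBoundedUnder.isCoboundedUnder_ge (isBoundedUnder_of ⟨1, fun N => ?_⟩)
    refine div_le_one_of_le₀ ?_ (Nat.cast_nonneg _)
    exact_mod_cast Set.ncard_le_ncard Set.inter_subset_right (SLbox_finite N)
end

section
/- Let G be a countably infinite (discrete) abelian group, let Φ be a Følner sequence in G, and let c ∈ (0,1). Then there exists a set A ⊆ G such that the density d_Φ(A) exists and equals c, and for every g ∈ G the shift g + A = {g + a : a ∈ A} is not a set of measurable recurrence (that is, A is a Straus set of density c). -/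
open Filter MeasureTheory

/-- A Følner sequence in an additive semigroup `G`. -/
def AddIsFolner {G : Type*} [AddSemigroup G] [DecidableEq G] (Φ : ℕ → Finset G) : Prop :=
  (∀ n, (Φ n).Nonempty) ∧
  ∀ g : G, Tendsto
    (fun n => ((Φ n ∩ (Φ n).image (fun x => g + x)).card : ℝ) / (Φ n).card)
    atTop (nhds 1)

/-- `A ⊆ G` is a set of measurable recurrence if for every measure-preserving
action of `G` on a probability space `(X, μ)` and every measurable `Y` with
`μ(Y) > 0` there is `g ∈ A`, `g ≠ 0`, with `μ(Y ∩ T_g⁻¹ Y) > 0`. -/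
def IsAddRecurrenceSet {G : Type*} [AddGroup G] (A : Set G) : Prop :=
  ∀ (X : Type) (_ : MeasurableSpace X) (μ : Measure X),
    IsProbabilityMeasure μ →
    ∀ T : G → X → X,
      (∀ g h : G, T (g + h) = T g ∘ T h) →
      (∀ g : G, MeasurePreserving (T g) μ μ) →
      ∀ Y : Set X, MeasurableSet Y → 0 < μ Y →
        ∃ g ∈ A, g ≠ 0 ∧ 0 < μ (Y ∩ T g ⁻¹' Y)

section Recurrence

variable {G : Type*} [AddCommGroup G]

theorem IsAddRecurrenceSet.mono {A B : Set G} (h : A ⊆ B) (hA : IsAddRecurrenceSet A) :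
    IsAddRecurrenceSet B := by
  intro X mX μ hμ T hT hT' Y hY hY0
  obtain ⟨g, hg, h0, hpos⟩ := hA X mX μ hμ T hT hT' Y hY hY0
  exact ⟨g, h hg, h0, hpos⟩

/-- Sets of recurrence are partition regular. -/
theorem not_isAddRecurrenceSet_union {A B : Set G} (hA : ¬ IsAddRecurrenceSet A)
    (hB : ¬ IsAddRecurrenceSet B) : ¬ IsAddRecurrenceSet (A ∪ B) := by
  unfold IsAddRecurrenceSet at hA hB
  push Not at hA hB
  obtain ⟨X, mX, μ, hμ, T, hT, hT', Y, hY, hY0, hAY⟩ := hA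
  obtain ⟨Z, mZ, ν, hν, S, hS, hS', W, hW, hW0, hBW⟩ := hB
  intro h
  obtain ⟨g, hg, h0, hpos⟩ := h (X × Z) inferInstance (μ.prod ν) inferInstance
    (fun g => Prod.map (T g) (S g)) (fun g h => by rw [hT, hS, Prod.map_comp_map])
    (fun g => (hT' g).prod (hS' g)) (Y ×ˢ W) (hY.prod hW)
    (by rw [Measure.prod_prod]; exact ENNReal.mul_pos hY0.ne' hW0.ne')
  have hprod : Y ×ˢ W ∩ Prod.map (T g) (S g) ⁻¹' Y ×ˢ W
      = (Y ∩ T g ⁻¹' Y) ×ˢ (W ∩ S g ⁻¹' W) := by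
    rw [← Set.prod_inter_prod]; rfl
  rw [hprod, Measure.prod_prod] at hpos
  rcases hg with hg | hg
  · simp [le_zero_iff.1 (hAY g hg h0)] at hpos
  · simp [le_zero_iff.1 (hBW g hg h0)] at hpos

theorem not_isAddRecurrenceSet_biUnion {ι : Type*} {s : Set ι} (hs : s.Finite) {A : ι → Set G}
    (hA : ∀ i ∈ s, ¬ IsAddRecurrenceSet (A i)) : ¬ IsAddRecurrenceSet (⋃ i ∈ s, A i) := by
  induction s, hs using Set.Finite.induction_on with
  | empty =>
    intro h
    obtain ⟨g, hg, -⟩ := h Unit ⊤ (Measure.dirac ()) inferInstance (fun _ => id)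
      (fun _ _ => rfl) (fun _ => MeasurePreserving.id _) Set.univ MeasurableSet.univ (by simp)
    simp at hg
  | insert _ _ ih =>
    rw [Set.biUnion_insert]
    exact not_isAddRecurrenceSet_union (hA _ (Set.mem_insert _ _))
      (ih fun i hi => hA i (Set.mem_insert_of_mem _ hi))

/-- The complement of a Bohr neighbourhood of zero is not a set of recurrence. -/
theorem not_isAddRecurrenceSet_le_norm (χ : G →+ AddCircle (1 : ℝ)) {r : ℝ} (hr : 0 < r) :
    ¬ IsAddRecurrenceSet {x | r ≤ ‖χ x‖} := by
  intro h
  have : Fact ((0 : ℝ) < 1) := ⟨one_pos⟩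
  obtain ⟨g, hg, -, hpos⟩ := h (AddCircle (1 : ℝ)) inferInstance volume
    ⟨by simp [AddCircle.measure_univ]⟩ (fun g x => χ g + x)
    (fun g h => by ext x; simp [add_assoc])
    (fun g => measurePreserving_add_left volume (χ g)) (Metric.ball 0 (r / 2))
    Metric.isOpen_ball.measurableSet
    (Metric.isOpen_ball.measure_pos _ (Metric.nonempty_ball.2 (half_pos hr)))
  obtain ⟨x, hx, hgx⟩ := nonempty_of_measure_ne_zero hpos.ne'
  simp only [Set.mem_preimage, mem_ball_zero_iff] at hx hgx
  have := norm_sub_le (χ g + x) x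
  rw [add_sub_cancel_right] at this
  exact (hg.trans this).not_gt (by linarith)

end Recurrence

section Density

variable {G : Type*}

open Classical in
/-- The relative density of `S` in the finite set `F`. -/
noncomputable def relDensity (F : Finset G) (S : Set G) : ℝ :=
  ((F.filter (fun x => x ∈ S)).card : ℝ) / F.card

theorem relDensity_mono (F : Finset G) {S T : Set G} (h : ∀ x ∈ F, x ∈ S → x ∈ T) :
    relDensity F S ≤ relDensity F T := by
  classical
  unfold relDensity
  gcongr 2
  exact_mod_cast Finset.card_le_card fun x hx => by
    simp only [Finset.mem_filter] at hx ⊢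
    exact ⟨hx.1, h x hx.1 hx.2⟩

theorem relDensity_union_le (F : Finset G) (S T : Set G) :
    relDensity F (S ∪ T) ≤ relDensity F S + relDensity F T := by
  classical
  unfold relDensity
  rw [← add_div]
  gcongr
  simp only [Set.mem_union, Finset.filter_or]
  exact_mod_cast Finset.card_union_le _ _

theorem relDensity_compl {F : Finset G} (hF : F.Nonempty) (S : Set G) :
    relDensity F Sᶜ = 1 - relDensity F S := by
  classical
  have hF' : (F.card : ℝ) ≠ 0 := by exact_mod_cast hF.card_pos.ne'
  unfold relDensity
  rw [eq_sub_iff_add_eq, ← add_div, div_eq_one_iff_eq hF', add_comm]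
  simp only [Set.mem_compl_iff]
  exact_mod_cast Finset.card_filter_add_card_filter_not (s := F) (fun x => x ∈ S)

theorem relDensity_preimage {α : Type*} (p : G → α) (F : Finset G) (S : Finset α) :
    relDensity F (p ⁻¹' S) = ∑ a ∈ S, relDensity F (p ⁻¹' {a}) := by
  classical
  unfold relDensity
  rw [← Finset.sum_div]
  congr 1
  norm_cast
  rw [Finset.card_eq_sum_card_fiberwise (f := p) (t := S)
    (fun x hx => by simpa using (Finset.mem_filter.1 hx).2)]
  refine Finset.sum_congr rfl fun a ha => congrArg Finset.card ?_
  ext x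
  simp only [Finset.mem_filter, Set.mem_preimage, Finset.mem_coe, Set.mem_singleton_iff]
  grind

theorem relDensity_biUnion_le {ι : Type*} (F : Finset G) (s : Finset ι) (S : ι → Set G) :
    relDensity F (⋃ i ∈ s, S i) ≤ ∑ i ∈ s, relDensity F (S i) := by
  classical
  induction s using Finset.induction_on with
  | empty => simp [relDensity]
  | insert i s hi ih =>
    rw [Finset.set_biUnion_insert, Finset.sum_insert hi]
    exact (relDensity_union_le _ _ _).trans (by gcongr)

variable [AddCommGroup G]

theorem relDensity_le_add_of_translate [DecidableEq G] {F : Finset G} (hF : F.Nonempty)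
    {S T : Set G} (h : G) (hST : ∀ x, h + x ∈ T → x ∈ S) :
    relDensity F T ≤
      relDensity F S + (1 - ((F ∩ F.image (fun x => h + x)).card : ℝ) / F.card) := by
  classical
  have hF' : (0 : ℝ) < F.card := by exact_mod_cast hF.card_pos
  unfold relDensity
  rw [one_sub_div hF'.ne', ← add_div]
  gcongr
  have hsub : F.filter (fun x => x ∈ T) ⊆
      (F.filter (fun x => x ∈ S)).image (fun x => h + x) ∪ F \ F.image (fun x => h + x) := by
    intro x hx
    simp only [Finset.mem_union, Finset.mem_image, Finset.mem_filter, Finset.mem_sdiff] at hx ⊢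
    by_cases hx' : ∃ a ∈ F, h + a = x
    · obtain ⟨a, ha, rfl⟩ := hx'
      exact Or.inl ⟨a, ⟨ha, hST a hx.2⟩, rfl⟩
    · exact Or.inr ⟨hx.1, hx'⟩
  have h1 := (Finset.card_le_card hsub).trans (Finset.card_union_le _ _)
  have h2 := Finset.card_inter_add_card_sdiff F (F.image (fun x => h + x))
  have h3 := Finset.card_image_le (s := F.filter (fun x => x ∈ S)) (f := fun x => h + x)
  have h4 : (F.filter (fun x => x ∈ T)).card + (F ∩ F.image (fun x => h + x)).card ≤
      (F.filter (fun x => x ∈ S)).card + F.card := by omega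
  have h5 : ((F.filter (fun x => x ∈ T)).card : ℝ) + (F ∩ F.image (fun x => h + x)).card ≤
      (F.filter (fun x => x ∈ S)).card + F.card := by exact_mod_cast h4
  linarith

theorem AddIsFolner.tendsto_relDensity_sub [DecidableEq G] {Φ : ℕ → Finset G}
    (hΦ : AddIsFolner Φ) {S T : Set G} (h : G) (hST : ∀ x, x ∈ S ↔ h + x ∈ T) :
    Tendsto (fun n => relDensity (Φ n) T - relDensity (Φ n) S) atTop (nhds 0) := by
  have hlim : ∀ g : G, Tendsto
      (fun n => 1 - ((Φ n ∩ (Φ n).image (fun x => g + x)).card : ℝ) / (Φ n).card)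
      atTop (nhds 0) := fun g => by simpa using (hΦ.2 g).const_sub 1
  have hneg := (hlim (-h)).neg
  rw [neg_zero] at hneg
  refine tendsto_of_tendsto_of_tendsto_of_le_of_le hneg (hlim h)
    (fun n => ?_) (fun n => ?_)
  · have := relDensity_le_add_of_translate (hΦ.1 n) (S := T) (T := S) (-h)
      (fun x hx => by simpa using (hST _).1 hx)
    dsimp only
    linarith
  · have := relDensity_le_add_of_translate (hΦ.1 n) (S := S) (T := T) h (fun x => (hST x).2)
    dsimp only
    linarith

/-- If the fibres of a map to a finite set are translates of one another, they all have the same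
density along every Følner sequence. -/
theorem AddIsFolner.tendsto_relDensity_fiber [DecidableEq G] {Φ : ℕ → Finset G}
    (hΦ : AddIsFolner Φ) {α : Type*} [Fintype α] {p : G → α}
    (hp : ∀ a b, ∃ h, ∀ x, p x = a ↔ p (h + x) = b) (a : α) :
    Tendsto (fun n => relDensity (Φ n) (p ⁻¹' {a})) atTop (nhds (1 / Fintype.card α)) := by
  have hsum : Tendsto
      (fun n => ∑ b : α, (relDensity (Φ n) (p ⁻¹' {b}) - relDensity (Φ n) (p ⁻¹' {a})))
      atTop (nhds 0) := by
    rw [← Finset.sum_const_zero (s := (Finset.univ : Finset α))]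
    refine tendsto_finsetSum _ fun b _ => ?_
    obtain ⟨h, hh⟩ := hp a b
    exact hΦ.tendsto_relDensity_sub h (by simpa using hh)
  have hcard : (Fintype.card α : ℝ) ≠ 0 := by
    exact_mod_cast (Fintype.card_pos_iff.2 ⟨a⟩).ne'
  have key : ∀ n, relDensity (Φ n) (p ⁻¹' {a}) =
      (1 - ∑ b : α, (relDensity (Φ n) (p ⁻¹' {b}) - relDensity (Φ n) (p ⁻¹' {a})))
        / Fintype.card α := by
    intro n
    have h1 : ∑ b : α, relDensity (Φ n) (p ⁻¹' {b}) = 1 := by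
      have hF : ((Φ n).card : ℝ) ≠ 0 := by exact_mod_cast (hΦ.1 n).card_pos.ne'
      rw [← relDensity_preimage]
      simp [relDensity, hF]
    rw [Finset.sum_sub_distrib, h1]
    simp only [Finset.sum_const, Finset.card_univ, nsmul_eq_mul]
    field_simp
    ring
  have hlim := (hsum.const_sub 1).div_const (Fintype.card α : ℝ)
  rw [sub_zero] at hlim
  exact hlim.congr fun n => (key n).symm

theorem AddIsFolner.tendsto_relDensity_preimage [DecidableEq G] {Φ : ℕ → Finset G}
    (hΦ : AddIsFolner Φ) {α : Type*} [Fintype α] {p : G → α}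
    (hp : ∀ a b, ∃ h, ∀ x, p x = a ↔ p (h + x) = b) (S : Finset α) :
    Tendsto (fun n => relDensity (Φ n) (p ⁻¹' S)) atTop (nhds (S.card / Fintype.card α)) := by
  simp_rw [relDensity_preimage]
  have := tendsto_finsetSum S fun a _ => hΦ.tendsto_relDensity_fiber hp a
  rwa [Finset.sum_const, nsmul_eq_mul, mul_one_div] at this

end Density

section UpperBound

variable {G : Type*}

/-- Along a sequence of finite sets for which singletons are null, an increasing sequence of sets
whose densities increase to `t` has, up to finite sets, an upper bound of density `t`. -/
theorem exists_almost_upper_bound {Φ : ℕ → Finset G}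
    (hpt : ∀ x : G, Tendsto (fun n => relDensity (Φ n) {x}) atTop (nhds 0))
    {U : ℕ → Set G} (hU : Monotone U) {u : ℕ → ℝ} {t : ℝ}
    (hu : ∀ j, Tendsto (fun n => relDensity (Φ n) (U j)) atTop (nhds (u j)))
    (hut : ∀ j, u j ≤ t) (hlim : Tendsto u atTop (nhds t)) :
    ∃ B : Set G, Tendsto (fun n => relDensity (Φ n) B) atTop (nhds t) ∧
      ∀ j, (U j \ B).Finite := by
  classical
  have hev : ∀ j : ℕ, ∀ᶠ k in atTop, ∀ n ≥ k, relDensity (Φ n) (U j) < t + 1 / (j + 1 : ℝ) := by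
    intro j
    have h : ∀ᶠ n in atTop, relDensity (Φ n) (U j) < t + 1 / (j + 1 : ℝ) :=
      (hu j).eventually_lt_const ((hut j).trans_lt (lt_add_of_pos_right t Nat.one_div_pos_of_nat))
    exact eventually_forall_ge_atTop.2 h
  obtain ⟨m, hm, hmU⟩ := extraction_forall_of_eventually hev
  let B : Set G := {x | ∃ j, x ∈ U j ∧ ∀ n < m j, x ∉ Φ n}
  have hfin : ∀ j, (U j \ B).Finite := by
    intro j
    refine ((Finset.range (m j)).biUnion Φ).finite_toSet.subset fun x hx => ?_
    by_contra hx'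
    refine hx.2 ⟨j, hx.1, fun n hn hxn => hx' ?_⟩
    simp only [Finset.mem_coe, Finset.mem_biUnion, Finset.mem_range]
    exact ⟨n, hn, hxn⟩
  have hnull : ∀ s : Finset G, Tendsto (fun n => relDensity (Φ n) s) atTop (nhds 0) := by
    intro s
    have h := tendsto_finsetSum s fun x _ => hpt x
    rw [Finset.sum_const_zero] at h
    refine squeeze_zero (fun n => by unfold relDensity; positivity) (fun n => ?_) h
    have hs : (s : Set G) = ⋃ x ∈ s, {x} := by ext; simp
    rw [hs]
    exact relDensity_biUnion_le (Φ n) s fun x => {x}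
  refine ⟨B, ?_, hfin⟩
  rw [tendsto_order]
  constructor
  · intro a ha
    obtain ⟨j, hj⟩ := (hlim.eventually_const_lt ha).exists
    have h := (hu j).sub (hnull (hfin j).toFinset)
    rw [sub_zero] at h
    filter_upwards [h.eventually_const_lt hj] with n hn
    have h1 := relDensity_mono (Φ n) (S := U j) (T := B ∪ (hfin j).toFinset) fun x _ hx => by
      by_cases hxB : x ∈ B
      · exact Or.inl hxB
      · exact Or.inr (by simpa using ⟨hx, hxB⟩)
    have h2 := relDensity_union_le (Φ n) B (hfin j).toFinset
    linarith
  · intro a ha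
    obtain ⟨J, hJ⟩ := exists_nat_one_div_lt (sub_pos.2 ha)
    filter_upwards [eventually_ge_atTop (m J)] with n hn
    have hJn : J ≤ n := (hm.le_apply).trans hn
    set j := Nat.findGreatest (fun i => m i ≤ n) n with hj
    have hmj : m j ≤ n := Nat.findGreatest_spec (P := fun i => m i ≤ n) hJn hn
    have hJj : J ≤ j := Nat.le_findGreatest hJn hn
    have h1 : relDensity (Φ n) B ≤ relDensity (Φ n) (U j) := by
      refine relDensity_mono _ fun x hx hxB => ?_
      obtain ⟨i, hxi, hi⟩ := hxB
      have hin : m i ≤ n := by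
        by_contra hlt
        exact hi n (not_le.1 hlt) hx
      exact hU (Nat.le_findGreatest ((hm.le_apply).trans hin) hin) hxi
    have h2 := hmU j n hmj
    have h3 : 1 / (j + 1 : ℝ) ≤ 1 / (J + 1 : ℝ) := by gcongr
    linarith

end UpperBound

section Construction

variable {G : Type*} [AddCommGroup G]

/-- A refining sequence of finite partitions into mutually translated cells, all of whose cells are
Bohr neighbourhoods of their points, gives rise to Straus sets of every density. -/
theorem AddIsFolner.exists_straus_set_of_partitions [Countable G] [DecidableEq G]
    {Φ : ℕ → Finset G} (hΦ : AddIsFolner Φ) {c : ℝ} (hc : c ∈ Set.Ioo (0 : ℝ) 1)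
    {α : ℕ → Type*} [∀ k, Fintype (α k)] (p : ∀ k, G → α k)
    (hp : ∀ k a b, ∃ h, ∀ x, p k x = a ↔ p k (h + x) = b)
    (href : ∀ k x y, p (k + 1) x = p (k + 1) y → p k x = p k y)
    (hcard : Tendsto (fun k => Fintype.card (α k)) atTop atTop)
    (hsep : ∀ x : G, x ≠ 0 → ¬ IsAddRecurrenceSet {x})
    (hrec : ∀ k g, ¬ IsAddRecurrenceSet {y | p k (y + g) ≠ p k g}) :
    ∃ A : Set G, Tendsto (fun n => relDensity (Φ n) A) atTop (nhds c) ∧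
      ∀ g : G, ¬ IsAddRecurrenceSet ((fun a => g + a) '' A) := by
  classical
  obtain ⟨hc0, hc1⟩ := hc
  have href' : ∀ k l, k ≤ l → ∀ x y, p l x = p l y → p k x = p k y := by
    intro k l hkl
    induction l, hkl using Nat.le_induction with
    | base => exact fun x y h => h
    | succ l _ ih => exact fun x y h => ih x y (href l x y h)
  have hdens := fun k => hΦ.tendsto_relDensity_preimage (hp k)
  have hcard' : Tendsto (fun k => (Fintype.card (α k) : ℝ)) atTop atTop :=
    tendsto_natCast_atTop_atTop.comp hcard
  have hinv : Tendsto (fun k => 1 / (Fintype.card (α k) : ℝ)) atTop (nhds 0) :=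
    hcard'.const_div_atTop 1
  have hne : ∀ k, (0 : ℝ) < Fintype.card (α k) := fun k => by
    exact_mod_cast Fintype.card_pos_iff.2 ⟨p k 0⟩
  -- a saturated set of density below `1 - c` can be enlarged to absorb the cell of a given point
  have step : ∀ (U : {U : Set G // ∃ k, ∃ S : Finset (α k), U = p k ⁻¹' S ∧
      (S.card : ℝ) / Fintype.card (α k) < 1 - c}) (g : G) (ε : ℝ), 0 < ε →
      ∃ U' : {U : Set G // ∃ k, ∃ S : Finset (α k), U = p k ⁻¹' S ∧
        (S.card : ℝ) / Fintype.card (α k) < 1 - c}, U.1 ⊆ U'.1 ∧ (∃ l, p l ⁻¹' {p l g} ⊆ U'.1) ∧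
        ∃ u, Tendsto (fun n => relDensity (Φ n) U'.1) atTop (nhds u) ∧
          1 - c - ε < u ∧ u < 1 - c := by
    rintro ⟨U, k, S, hUS, hS⟩ g ε hε
    obtain ⟨l, hl1, hl2, hkl⟩ := ((hinv.eventually_lt_const hε).and
      ((hinv.eventually_lt_const (sub_pos.2 hS)).and (eventually_ge_atTop k))).exists
    set N : ℝ := (Fintype.card (α l) : ℝ) with hN
    have hNpos : 0 < N := hne l
    let S' : Finset (α l) := Finset.univ.filter fun b => ∃ x, p l x = b ∧ p k x ∈ S
    have hUS' : U = p l ⁻¹' S' := by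
      rw [hUS]
      ext x
      simp only [Set.mem_preimage, Finset.mem_coe, S', Finset.mem_filter, Finset.mem_univ,
        true_and]
      refine ⟨fun hx => ⟨x, rfl, hx⟩, ?_⟩
      rintro ⟨y, hyx, hy⟩
      rwa [← href' k l hkl y x hyx]
    have hS' : (S'.card : ℝ) / N = S.card / Fintype.card (α k) := by
      refine tendsto_nhds_unique (hdens l S') ?_
      rw [← hUS', hUS]
      exact hdens k S
    have hins : ((insert (p l g) S').card : ℝ) < (1 - c) * N := by
      have h1 : ((insert (p l g) S').card : ℝ) ≤ S'.card + 1 := by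
        exact_mod_cast Finset.card_insert_le _ _
      rw [← hS', ← sub_pos, sub_sub, ← add_div, sub_pos, div_lt_iff₀ hNpos] at hl2
      linarith
    have hceil := Nat.lt_ceil.2 hins
    obtain ⟨S'', hsub, hS''⟩ := Finset.exists_superset_card_eq
      (s := insert (p l g) S') (n := ⌈(1 - c) * N⌉₊ - 1) (by omega) (by
        have : ⌈(1 - c) * N⌉₊ ≤ Fintype.card (α l) := Nat.ceil_le.2 (by nlinarith)
        omega)
    have hlt : (S''.card : ℝ) < (1 - c) * N := Nat.lt_ceil.1 (by omega)
    have hge : (1 - c) * N ≤ S''.card + 1 := by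
      refine (Nat.le_ceil _).trans ?_
      exact_mod_cast (by omega : ⌈(1 - c) * N⌉₊ ≤ S''.card + 1)
    have hlt' : (S''.card : ℝ) / N < 1 - c := (div_lt_iff₀ hNpos).2 hlt
    refine ⟨⟨p l ⁻¹' S'', l, S'', rfl, hlt'⟩, ?_, ⟨l, ?_⟩, S''.card / N, hdens l S'', ?_, hlt'⟩
    · exact fun x hx => hsub (Finset.mem_insert_of_mem (hUS'.subset hx))
    · intro x hx
      exact hsub (Finset.mem_insert.2 (Or.inl hx))
    · have h1 : 1 - c ≤ S''.card / N + 1 / N := by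
        rw [← add_div, le_div_iff₀ hNpos]
        exact hge
      linarith
  choose next hnext_sub hnext_cell hnext_dens using step
  obtain ⟨e, he⟩ := exists_surjective_nat G
  let V : ℕ → {U : Set G // ∃ k, ∃ S : Finset (α k), U = p k ⁻¹' S ∧
      (S.card : ℝ) / Fintype.card (α k) < 1 - c} := fun j =>
    Nat.rec ⟨∅, 0, ∅, by simp, by simpa using hc1⟩
      (fun j U => next U (e j) (1 / (j + 1 : ℝ)) Nat.one_div_pos_of_nat) j
  have hVmono : Monotone fun j => (V j).1 :=
    monotone_nat_of_le_succ fun j => hnext_sub (V j) (e j) _ _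
  choose u hu hu_lower hu_upper using fun j : ℕ =>
    hnext_dens (V j) (e j) (1 / (j + 1 : ℝ)) Nat.one_div_pos_of_nat
  have hulim : Tendsto u atTop (nhds (1 - c)) := by
    refine tendsto_of_tendsto_of_tendsto_of_le_of_le ?_ tendsto_const_nhds
      (fun j => (hu_lower j).le) (fun j => (hu_upper j).le)
    simpa using (tendsto_one_div_add_atTop_nhds_zero_nat (𝕜 := ℝ)).const_sub (1 - c)
  have hpt : ∀ x : G, Tendsto (fun n => relDensity (Φ n) {x}) atTop (nhds 0) := by
    intro x
    rw [tendsto_order]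
    refine ⟨fun a ha => Eventually.of_forall fun n =>
      ha.trans_le (by unfold relDensity; positivity), fun a ha => ?_⟩
    obtain ⟨k, hk⟩ := (hinv.eventually_lt_const ha).exists
    filter_upwards [(hΦ.tendsto_relDensity_fiber (hp k) (p k x)).eventually_lt_const hk] with n hn
    refine (relDensity_mono _ fun y _ hy => ?_).trans_lt hn
    rw [hy]
    rfl
  obtain ⟨B, hB, hVB⟩ := exists_almost_upper_bound hpt (U := fun j => (V (j + 1)).1)
    (fun i j hij => hVmono (Nat.succ_le_succ hij)) hu (fun j => (hu_upper j).le) hulim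
  refine ⟨Bᶜ, ?_, fun g => ?_⟩
  · have h := hB.const_sub 1
    rw [sub_sub_cancel] at h
    exact h.congr fun n => (relDensity_compl (hΦ.1 n) B).symm
  · obtain ⟨j, hj⟩ := he (-g)
    obtain ⟨l, hl⟩ := hnext_cell (V j) (e j) (1 / (j + 1 : ℝ)) Nat.one_div_pos_of_nat
    replace hl : p l ⁻¹' {p l (e j)} ⊆ (V (j + 1)).1 := hl
    rw [hj] at hl
    have hfin : (((fun a => g + a) '' ((V (j + 1)).1 \ B)) \ {0}).Finite :=
      ((hVB j).image _).sdiff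
    have h1 := not_isAddRecurrenceSet_biUnion hfin (A := fun x => {x}) fun x hx => hsep x hx.2
    have h2 := not_isAddRecurrenceSet_union (hrec l (-g)) h1
    refine fun h3 => h2 ?_
    intro X mX μ hμ T hT hT' Y hY hY0
    obtain ⟨x, ⟨a, ha, hax⟩, hx0, hpos⟩ := h3 X mX μ hμ T hT hT' Y hY hY0
    refine ⟨x, ?_, hx0, hpos⟩
    dsimp only at hax
    by_cases hcell : p l a = p l (-g)
    · refine Or.inr ?_
      rw [Set.biUnion_of_singleton]
      exact ⟨⟨a, ⟨hl hcell, ha⟩, hax⟩, hx0⟩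
    · refine Or.inl ?_
      have : x + -g = a := by rw [← hax]; abel
      rwa [Set.mem_ofPred_eq, this]

end Construction

section Characters

/-- The inclusion of `ℚ / ℤ` into `ℝ / ℤ`. -/
noncomputable def ratCircleToReal : AddCircle (1 : ℚ) →+ AddCircle (1 : ℝ) :=
  QuotientAddGroup.map _ _ (Rat.castHom ℝ).toAddMonoidHom (by
    rw [AddSubgroup.zmultiples_le, AddSubgroup.mem_comap]
    simp)

@[simp]
theorem ratCircleToReal_coe (q : ℚ) :
    ratCircleToReal (q : AddCircle (1 : ℚ)) = ((q : ℝ) : AddCircle (1 : ℝ)) :=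
  rfl

theorem ratCircleToReal_injective : Function.Injective ratCircleToReal := by
  rw [injective_iff_map_eq_zero]
  intro x hx
  induction x using QuotientAddGroup.induction_on with
  | H q =>
    obtain ⟨n, hn⟩ := (AddCircle.coe_eq_zero_iff (1 : ℝ)).1 hx
    refine (AddCircle.coe_eq_zero_iff (1 : ℚ)).2 ⟨n, ?_⟩
    replace hn : n • (1 : ℝ) = (q : ℝ) := hn
    simp only [zsmul_eq_mul, mul_one] at hn ⊢
    exact_mod_cast hn

variable {G : Type*} [AddCommGroup G]

theorem exists_ratCircle_character_ne_zero {x : G} (hx : x ≠ 0) :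
    ∃ χ : G →+ AddCircle (1 : ℚ), χ x ≠ 0 :=
  CharacterModule.exists_character_apply_ne_zero_of_ne_zero hx

theorem not_isAddRecurrenceSet_of_image_finite {A : Set G} (χ : G →+ AddCircle (1 : ℚ))
    (hA : (χ '' A).Finite) (h0 : ∀ x ∈ A, χ x ≠ 0) : ¬ IsAddRecurrenceSet A := by
  refine mt (IsAddRecurrenceSet.mono fun x hx => ?_)
    (not_isAddRecurrenceSet_biUnion hA
      (A := fun v => {x | ‖ratCircleToReal v‖ ≤ ‖ratCircleToReal.comp χ x‖}) ?_)
  · exact Set.mem_biUnion (Set.mem_image_of_mem χ hx) (le_refl ‖ratCircleToReal (χ x)‖)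
  · rintro _ ⟨x, hx, rfl⟩
    refine not_isAddRecurrenceSet_le_norm _ (norm_pos_iff.2 ?_)
    rw [map_ne_zero_iff _ ratCircleToReal_injective]
    exact h0 x hx

theorem not_isAddRecurrenceSet_singleton {x : G} (hx : x ≠ 0) :
    ¬ IsAddRecurrenceSet ({x} : Set G) := by
  obtain ⟨χ, hχ⟩ := exists_ratCircle_character_ne_zero hx
  exact not_isAddRecurrenceSet_of_image_finite χ (by simp) (by simpa using hχ)

/-- Straus sets in groups all of whose rational characters have finite image. -/
theorem AddIsFolner.exists_straus_set_of_finite_range [Countable G] [Infinite G] [DecidableEq G]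
    {Φ : ℕ → Finset G} (hΦ : AddIsFolner Φ) {c : ℝ} (hc : c ∈ Set.Ioo (0 : ℝ) 1)
    (hfin : ∀ χ : G →+ AddCircle (1 : ℚ), (Set.range χ).Finite) :
    ∃ A : Set G, Tendsto (fun n => relDensity (Φ n) A) atTop (nhds c) ∧
      ∀ g : G, ¬ IsAddRecurrenceSet ((fun a => g + a) '' A) := by
  classical
  obtain ⟨e, he⟩ := exists_surjective_nat G
  have hχ : ∀ i, ∃ χ : G →+ AddCircle (1 : ℚ), e i ≠ 0 → χ (e i) ≠ 0 := by
    intro i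
    by_cases h : e i = 0
    · exact ⟨0, fun h' => (h' h).elim⟩
    · exact (exists_ratCircle_character_ne_zero h).imp fun χ hχ _ => hχ
  choose χ hχ using hχ
  let F : ∀ k : ℕ, G →+ (Fin k → AddCircle (1 : ℚ)) := fun k =>
    AddMonoidHom.mk' (fun x i => χ i x) (fun x y => by ext i; simp)
  have hF : ∀ k x y, F k x = F k y ↔ ∀ i < k, χ i (x - y) = 0 := by
    intro k x y
    simp only [funext_iff, map_sub, sub_eq_zero]
    exact ⟨fun h i hi => h ⟨i, hi⟩, fun h i => h i i.2⟩
  have hfinF : ∀ k, (Set.range (F k)).Finite := fun k =>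
    (Set.Finite.pi' fun i : Fin k => hfin (χ i)).subset (by
      rintro _ ⟨x, rfl⟩ i
      exact ⟨x, rfl⟩)
  have : ∀ k, Fintype (Set.range (F k)) := fun k => (hfinF k).fintype
  refine hΦ.exists_straus_set_of_partitions hc (α := fun k => Set.range (F k))
    (fun k => Set.rangeFactorization (F k)) ?_ ?_ ?_
    (fun x hx => not_isAddRecurrenceSet_singleton hx) ?_
  · rintro k ⟨_, a, rfl⟩ ⟨_, b, rfl⟩
    refine ⟨b - a, fun x => ?_⟩
    refine Subtype.ext_iff.trans (Iff.trans ?_ Subtype.ext_iff.symm)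
    change F k x = F k a ↔ F k (b - a + x) = F k b
    rw [hF, hF, show b - a + x - b = x - a by abel]
  · intro k x y
    simp only [Set.rangeFactorization, Subtype.mk.injEq, hF]
    exact fun h i hi => h i (hi.trans k.lt_succ_self)
  · refine tendsto_atTop.2 fun M => ?_
    obtain ⟨T, hT⟩ := Infinite.exists_subset_card_eq G M
    have hsep : ∀ᶠ k in atTop, ∀ x ∈ T, ∀ y ∈ T, x ≠ y → F k x ≠ F k y := by
      rw [eventually_all_finset]
      intro x _
      rw [eventually_all_finset]
      intro y _
      obtain ⟨i, hi⟩ := he (x - y)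
      filter_upwards [eventually_gt_atTop i] with k hk hxy hFk
      exact hχ i (by rwa [hi, sub_ne_zero]) (hi ▸ (hF k x y).1 hFk i hk)
    filter_upwards [hsep] with k hk
    rw [← hT, ← Finset.card_univ]
    refine Finset.card_le_card_of_injOn (Set.rangeFactorization (F k)) (by simp) ?_
    intro x hx y hy hxy
    by_contra hne
    exact hk x hx y hy hne (congrArg Subtype.val hxy)
  · intro k g
    refine mt (IsAddRecurrenceSet.mono ?_) (not_isAddRecurrenceSet_biUnion (Set.finite_Iio k)
      (A := fun i => {y | χ i y ≠ 0}) fun i _ => not_isAddRecurrenceSet_of_image_finite (χ i)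
        ((hfin (χ i)).subset (Set.image_subset_range _ _)) fun x hx => hx)
    intro y hy
    simp only [Set.mem_ofPred_eq, Set.rangeFactorization, Subtype.mk.injEq, hF, ne_eq,
      add_sub_cancel_right, not_forall] at hy
    obtain ⟨i, hi, hy⟩ := hy
    exact Set.mem_biUnion (Set.mem_Iio.2 hi) hy

/-- An infinite image of a rational character contains `1 / N` for `N` arbitrarily large in the
divisibility order. -/
theorem exists_dvd_lt_of_infinite_range {χ : G →+ AddCircle (1 : ℚ)} (hχ : (Set.range χ).Infinite)
    {N : ℕ} (hN : 0 < N) (h : ∃ x, χ x = ((1 / N : ℚ) : AddCircle (1 : ℚ))) :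
    ∃ M : ℕ, N ∣ M ∧ N < M ∧ ∃ x, χ x = ((1 / M : ℚ) : AddCircle (1 : ℚ)) := by
  obtain ⟨x, hx⟩ := h
  obtain ⟨_, ⟨y, rfl⟩, hy⟩ := (hχ.sdiff (AddCircle.finite_torsion (1 : ℚ) hN)).nonempty
  obtain ⟨q, hq⟩ := QuotientAddGroup.mk_surjective (χ y)
  have hq' : χ y = (q : AddCircle (1 : ℚ)) := hq.symm
  have hden : (q.den : ℚ) ≠ 0 := by exact_mod_cast q.den_ne_zero
  have hNq : (N : ℚ) ≠ 0 := by exact_mod_cast hN.ne'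
  -- a multiple of `y` maps to `1 / q.den`
  have hcop : IsCoprime q.num (q.den : ℤ) := by
    rw [Int.isCoprime_iff_gcd_eq_one]; exact q.reduced
  obtain ⟨a, b, hab⟩ := hcop
  have hy1 : χ (a • y) = ((1 / q.den : ℚ) : AddCircle (1 : ℚ)) := by
    rw [map_zsmul, hq', ← AddCircle.coe_zsmul, ← sub_eq_zero, ← AddCircle.coe_sub,
      AddCircle.coe_eq_zero_iff]
    refine ⟨-b, ?_⟩
    have hab' : (a : ℚ) * q.num + b * q.den = 1 := by exact_mod_cast hab
    have hqq := Rat.mul_den_eq_num q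
    simp only [zsmul_eq_mul, mul_one, Int.cast_neg]
    field_simp
    rw [mul_assoc, hqq]
    linarith
  refine ⟨N.lcm q.den, Nat.dvd_lcm_left _ _, ?_, ?_⟩
  · refine lt_of_le_of_ne (Nat.le_of_dvd (Nat.lcm_pos hN q.den_pos) (Nat.dvd_lcm_left _ _)) ?_
    intro hlcm
    obtain ⟨d, hd⟩ : q.den ∣ N := hlcm ▸ Nat.dvd_lcm_right N q.den
    refine hy ?_
    rw [Set.mem_ofPred_eq, hq', ← AddCircle.coe_nsmul, AddCircle.coe_eq_zero_iff]
    refine ⟨d * q.num, ?_⟩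
    have hd' : (N : ℚ) = q.den * d := by exact_mod_cast hd
    have hqq := Rat.mul_den_eq_num q
    simp only [zsmul_eq_mul, nsmul_eq_mul, mul_one, Int.cast_mul, Int.cast_natCast]
    rw [hd', ← hqq]
    ring
  · refine ⟨Nat.gcdB N q.den • x + Nat.gcdA N q.den • a • y, ?_⟩
    rw [map_add, map_zsmul, map_zsmul _ _ (a • y), hy1, hx, ← AddCircle.coe_zsmul,
      ← AddCircle.coe_zsmul, ← AddCircle.coe_add]
    congr 1
    have h1 : ((N.gcd q.den : ℕ) : ℚ) = N * Nat.gcdA N q.den + q.den * Nat.gcdB N q.den := by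
      exact_mod_cast Nat.gcd_eq_gcd_ab N q.den
    have h2 : ((N.gcd q.den : ℕ) : ℚ) * (N.lcm q.den : ℕ) = N * q.den := by
      exact_mod_cast Nat.gcd_mul_lcm N q.den
    have h3 : ((N.lcm q.den : ℕ) : ℚ) ≠ 0 := by
      exact_mod_cast (Nat.lcm_pos hN q.den_pos).ne'
    simp only [zsmul_eq_mul]
    field_simp
    rw [← h2, h1]
    ring


theorem exists_dvd_chain_of_infinite_range {χ : G →+ AddCircle (1 : ℚ)}
    (hχ : (Set.range χ).Infinite) :
    ∃ N : ℕ → ℕ, (∀ k, 0 < N k) ∧ (∀ k, N k ∣ N (k + 1)) ∧ StrictMono N ∧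
      ∀ k, ∃ x, χ x = ((1 / N k : ℚ) : AddCircle (1 : ℚ)) := by
  have step : ∀ N : {N : ℕ // 0 < N ∧ ∃ x, χ x = ((1 / N : ℚ) : AddCircle (1 : ℚ))},
      ∃ M : {N : ℕ // 0 < N ∧ ∃ x, χ x = ((1 / N : ℚ) : AddCircle (1 : ℚ))},
        N.1 ∣ M.1 ∧ N.1 < M.1 := by
    rintro ⟨N, hN, h⟩
    obtain ⟨M, hNM, hlt, hM⟩ := exists_dvd_lt_of_infinite_range hχ hN h
    exact ⟨⟨M, hN.trans hlt, hM⟩, hNM, hlt⟩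
  choose next hnext_dvd hnext_lt using step
  let V : ℕ → {N : ℕ // 0 < N ∧ ∃ x, χ x = ((1 / N : ℚ) : AddCircle (1 : ℚ))} := fun k =>
    Nat.rec ⟨1, one_pos, 0, by simp [AddCircle.coe_period]⟩ (fun _ => next) k
  exact ⟨fun k => (V k).1, fun k => (V k).2.1, fun k => hnext_dvd (V k),
    strictMono_nat_of_lt_succ fun k => hnext_lt (V k), fun k => (V k).2.2⟩

/-- Straus sets in groups that have a rational character with infinite image. -/
theorem AddIsFolner.exists_straus_set_of_infinite_range [Countable G] [DecidableEq G]
    {Φ : ℕ → Finset G} (hΦ : AddIsFolner Φ) {c : ℝ} (hc : c ∈ Set.Ioo (0 : ℝ) 1)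
    {χ : G →+ AddCircle (1 : ℚ)} (hχ : (Set.range χ).Infinite) :
    ∃ A : Set G, Tendsto (fun n => relDensity (Φ n) A) atTop (nhds c) ∧
      ∀ g : G, ¬ IsAddRecurrenceSet ((fun a => g + a) '' A) := by
  classical
  obtain ⟨N, hNpos, hNdvd, hNmono, h⟩ := exists_dvd_chain_of_infinite_range hχ
  choose h hh using h
  have : ∀ k, NeZero (N k) := fun k => ⟨(hNpos k).ne'⟩
  -- rational lifts of the values of the character
  choose q hq using fun x => QuotientAddGroup.mk_surjective (χ x)
  have hq' : ∀ x, χ x = (q x : AddCircle (1 : ℚ)) := fun x => (hq x).symm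
  have hlift : ∀ x (r : ℚ), χ x = (r : AddCircle (1 : ℚ)) → ∃ n : ℤ, q x = r + n := by
    intro x r hr
    rw [hq', ← sub_eq_zero, ← AddCircle.coe_sub, AddCircle.coe_eq_zero_iff] at hr
    obtain ⟨n, hn⟩ := hr
    refine ⟨n, ?_⟩
    rw [zsmul_eq_mul, mul_one] at hn
    linarith
  have hadd : ∀ x y, ∃ n : ℤ, q (x + y) = q x + q y + n := fun x y =>
    hlift _ _ (by rw [map_add, hq', hq', AddCircle.coe_add])
  let p : ∀ k, G → ZMod (N k) := fun k x => ((⌊(N k : ℝ) * (q x + √2)⌋ : ℤ) : ZMod (N k))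
  -- moving by integers does not change the cell
  have hfloor : ∀ k (x : G) (t : ℝ) (n : ℤ), (q x : ℝ) + √2 = t + n →
      p k x = ((⌊(N k : ℝ) * t⌋ : ℤ) : ZMod (N k)) := by
    intro k x t n hx
    have : (N k : ℝ) * (q x + √2) = N k * t + ((N k * n : ℤ) : ℝ) := by
      rw [hx]; push_cast; ring
    simp only [p]
    rw [this, Int.floor_add_intCast]
    simp
  have htrans : ∀ k (i : ℕ) x, p k (i • h k + x) = p k x + i := by
    intro k i x
    obtain ⟨n, hn⟩ := hlift (i • h k + x) (i * (1 / N k) + q x) (by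
      rw [map_add, map_nsmul, hh, hq', AddCircle.coe_add, ← AddCircle.coe_nsmul, nsmul_eq_mul])
    have hNk : (N k : ℝ) ≠ 0 := by exact_mod_cast (hNpos k).ne'
    rw [hfloor k _ (i * (1 / N k) + q x + √2) n (by rw [hn]; push_cast; ring)]
    have : (N k : ℝ) * (i * (1 / N k) + q x + √2) = N k * (q x + √2) + (i : ℤ) := by
      field_simp
      push_cast
      ring
    rw [this, Int.floor_add_intCast]
    simp [p]
  refine hΦ.exists_straus_set_of_partitions hc (α := fun k => ZMod (N k)) p ?_ ?_ ?_
    (fun x hx => not_isAddRecurrenceSet_singleton hx) ?_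
  · intro k a b
    refine ⟨(b - a).val • h k, fun x => ?_⟩
    rw [htrans, ZMod.natCast_zmod_val]
    grind
  · intro k x y hxy
    obtain ⟨M, hM⟩ := hNdvd k
    have hMpos : 0 < M := Nat.pos_of_mul_pos_left (hM ▸ hNpos (k + 1))
    have hdiv : ∀ t : ℝ, ⌊(N k : ℝ) * t⌋ = ⌊(N (k + 1) : ℝ) * t⌋ / M := by
      intro t
      have hM' : (M : ℝ) ≠ 0 := by exact_mod_cast hMpos.ne'
      rw [← Int.floor_div_natCast, hM]
      congr 1
      push_cast
      field_simp
    simp only [p] at hxy ⊢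
    rw [hdiv, hdiv]
    rw [ZMod.intCast_eq_intCast_iff_dvd_sub] at hxy ⊢
    obtain ⟨d, hd⟩ := hxy
    refine ⟨d, ?_⟩
    have hM' : (M : ℤ) ≠ 0 := by exact_mod_cast hMpos.ne'
    rw [eq_add_of_sub_eq hd, hM, Nat.cast_mul, mul_comm (N k : ℤ), mul_assoc, add_comm,
      Int.add_mul_ediv_left _ _ hM']
    ring
  · simpa only [ZMod.card] using hNmono.tendsto_atTop
  · intro k g
    set s : ℝ := N k * (q g + √2) with hs
    have hNk : (0 : ℝ) < N k := by exact_mod_cast hNpos k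
    have hirr : Irrational s := by
      have : s = (N k : ℕ) * ((q g : ℚ) + √2) := hs
      rw [this]
      exact (irrational_sqrt_two.ratCast_add (q g)).natCast_mul (hNpos k).ne'
    have h0 : 0 < s - ⌊s⌋ :=
      sub_pos.2 ((Int.floor_le s).lt_of_ne fun h => hirr ⟨⌊s⌋, by simpa using h⟩)
    have h1 : 0 < ⌊s⌋ + 1 - s := sub_pos.2 (Int.lt_floor_add_one s)
    set r : ℝ := min (s - ⌊s⌋) (⌊s⌋ + 1 - s) / N k with hr
    have hrpos : 0 < r := div_pos (lt_min h0 h1) hNk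
    refine mt (IsAddRecurrenceSet.mono fun y hy => ?_)
      (not_isAddRecurrenceSet_le_norm (ratCircleToReal.comp χ) hrpos)
    rw [Set.mem_ofPred_eq] at hy ⊢
    by_contra hlt
    refine hy ?_
    rw [AddMonoidHom.comp_apply, hq', ratCircleToReal_coe, UnitAddCircle.norm_eq, not_le] at hlt
    set j : ℤ := round (q y : ℝ)
    obtain ⟨n, hn⟩ := hadd y g
    rw [hfloor k (y + g) (q y - j + q g + √2) (n + j) (by rw [hn]; push_cast; ring)]
    have hsplit : (N k : ℝ) * (q y - j + q g + √2) = s + N k * (q y - j) := by rw [hs]; ring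
    have hsmall : |(N k : ℝ) * (q y - j)| < min (s - ⌊s⌋) (⌊s⌋ + 1 - s) := by
      rw [abs_mul, abs_of_pos hNk, mul_comm, ← lt_div_iff₀ hNk]
      exact hlt
    obtain ⟨hl, hu⟩ := abs_lt.1 hsmall
    have hm1 := min_le_left (s - ⌊s⌋) (⌊s⌋ + 1 - s)
    have hm2 := min_le_right (s - ⌊s⌋) (⌊s⌋ + 1 - s)
    have : ⌊(N k : ℝ) * (q y - j + q g + √2)⌋ = ⌊s⌋ := by
      rw [hsplit, Int.floor_eq_iff]
      constructor <;> linarith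
    rw [this]

end Characters

open Classical in
/-- In any countably infinite abelian group `G` with Følner sequence `Φ`, for
every `c ∈ (0,1)` there is a Straus set of density `c`: a set `A` whose
density along `Φ` exists and equals `c` and no shift of which is a set of
measurable recurrence. -/
theorem exists_straus_set {G : Type*} [AddCommGroup G] [Countable G] [Infinite G]
    (Φ : ℕ → Finset G) (hΦ : AddIsFolner Φ) (c : ℝ) (hc : c ∈ Set.Ioo (0 : ℝ) 1) :
    ∃ A : Set G,
      Tendsto (fun n => (((Φ n).filter (fun x => x ∈ A)).card : ℝ) / (Φ n).card)
        atTop (nhds c) ∧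
      ∀ g : G, ¬ IsAddRecurrenceSet ((fun a => g + a) '' A) := by
  by_cases h : ∀ χ : G →+ AddCircle (1 : ℚ), (Set.range χ).Finite
  · exact hΦ.exists_straus_set_of_finite_range hc h
  · push Not at h
    obtain ⟨χ, hχ⟩ := h
    exact hΦ.exists_straus_set_of_infinite_range hc hχ
end
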